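/- arXiv:2103.00555 — 8 statements merged into one kernel-verified Lean document; each statement's English description precedes it below -/
import Mathlib

section
/- Suppose α + g(α) ≥ 1. Then the offline optimum never needs partial hosting: for every hosting sequence r there exists a hosting sequence r' with r'_t ∈ {0,1} for all t ∈ {1,…,T+1} and C(r') ≤ C(r). In particular, the offline optimal cost C^{α-OPT} is attained by a hosting sequence that never takes the value α. -/
open Finset

/-- Latency/forwarding cost per request at hosting level `v`:
`g 0 = 1`, `g 1 = 0`, and `g α = gα` for the intermediate level. -/
noncomputable def gfun (gα : ℝ) (v : ℝ) : ℝ :=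
  if v = 0 then 1 else if v = 1 then 0 else gα

/-- Total cost of a hosting sequence `r` over the horizon `T`:
rent cost + latency cost + fetch cost in each slot. -/
noncomputable def hostCost (gα M : ℝ) (x c : ℕ → ℝ) (T : ℕ) (r : ℕ → ℝ) : ℝ :=
  ∑ t ∈ Finset.Icc 1 T,
    (r t * c t + gfun gα (r t) * x t + M * max (r (t + 1) - r t) 0)

/-- A hosting sequence: starts in state `0` and takes values in `{0, α, 1}`. -/
def IsHosting (α : ℝ) (T : ℕ) (r : ℕ → ℝ) : Prop :=
  r 1 = 0 ∧ ∀ t ∈ Finset.Icc 1 (T + 1), r t ∈ ({0, α, 1} : Set ℝ)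

/-- An α-OPT (offline optimal) hosting sequence. -/
def IsOptSeq (α gα M : ℝ) (x c : ℕ → ℝ) (T : ℕ) (r : ℕ → ℝ) : Prop :=
  IsHosting α T r ∧
    ∀ r' : ℕ → ℝ, IsHosting α T r' → hostCost gα M x c T r ≤ hostCost gα M x c T r'

/-- if `α + g(α) ≥ 1`, the offline optimum never needs partial hosting:
every hosting sequence is dominated by one taking values in `{0, 1}` only. -/
theorem opt_no_partial_hosting
    (T : ℕ) (α gα M cmin cmax : ℝ) (x c : ℕ → ℝ)
    (hα : α ∈ Set.Ioo (0 : ℝ) 1) (hgα : gα ∈ Set.Ioo (0 : ℝ) 1) (hM : 1 < M)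
    (hx : ∀ t ∈ Finset.Icc 1 T, x t = 0 ∨ x t = 1)
    (hcmin : 0 < cmin) (hc : ∀ t ∈ Finset.Icc 1 T, cmin ≤ c t ∧ c t ≤ cmax)
    (hsum : 1 ≤ α + gα)
    (r : ℕ → ℝ) (hr : IsHosting α T r) :
    ∃ r' : ℕ → ℝ, IsHosting α T r' ∧
      (∀ t ∈ Finset.Icc 1 (T + 1), r' t = 0 ∨ r' t = 1) ∧
      hostCost gα M x c T r' ≤ hostCost gα M x c T r := by
  obtain ⟨h0, h1⟩ := hα
  obtain ⟨hr1, hrv⟩ := hr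
  have hα0 : α ≠ 0 := ne_of_gt h0
  have hα1 : α ≠ 1 := ne_of_lt h1
  set A : ℕ → ℝ := fun t => if r t = 0 then 0 else 1 with hA
  set B : ℕ → ℝ := fun t => if r t = 1 then 1 else 0 with hB
  have hA01 : ∀ t, A t = 0 ∨ A t = 1 := by
    intro t; simp only [hA]; split_ifs <;> simp
  have hB01 : ∀ t, B t = 0 ∨ B t = 1 := by
    intro t; simp only [hB]; split_ifs <;> simp
  have hAh : IsHosting α T A := by
    refine ⟨by simp [hA, hr1], fun t _ => ?_⟩
    rcases hA01 t with h | h <;> simp [h]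
  have hBh : IsHosting α T B := by
    refine ⟨by simp [hB, hr1], fun t _ => ?_⟩
    rcases hB01 t with h | h <;> simp [h]
  have key : α * hostCost gα M x c T A + (1 - α) * hostCost gα M x c T B
      ≤ hostCost gα M x c T r := by
    unfold hostCost
    rw [Finset.mul_sum, Finset.mul_sum, ← Finset.sum_add_distrib]
    apply Finset.sum_le_sum
    intro t ht
    have ht' := Finset.mem_Icc.mp ht
    have e1 := hrv t (Finset.mem_Icc.mpr ⟨ht'.1, by omega⟩)
    have e2 := hrv (t + 1) (Finset.mem_Icc.mpr ⟨by omega, by omega⟩)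
    simp only [Set.mem_insert_iff, Set.mem_singleton_iff] at e1 e2
    have hM' : max (r (t + 1) - r t) 0
        = α * max (A (t + 1) - A t) 0 + (1 - α) * max (B (t + 1) - B t) 0 := by
      rcases e1 with e | e | e <;> rcases e2 with f | f | f <;>
        simp [hA, hB, e, f, hα0, hα1, h0.le, h1.le]
    have hlin : α * (A t * c t + gfun gα (A t) * x t)
        + (1 - α) * (B t * c t + gfun gα (B t) * x t)
        ≤ r t * c t + gfun gα (r t) * x t := by
      have hx0 : 0 ≤ x t := by rcases hx t ht with h | h <;> simp [h]
      rcases e1 with e | e | e <;> simp [hA, hB, gfun, e, hα0, hα1]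
      · nlinarith
      · nlinarith
      · nlinarith
    rw [hM']
    linarith
  by_cases hle : hostCost gα M x c T A ≤ hostCost gα M x c T r
  · exact ⟨A, hAh, fun t _ => hA01 t, hle⟩
  · refine ⟨B, hBh, fun t _ => hB01 t, ?_⟩
    push Not at hle
    by_contra hb
    push Not at hb
    nlinarith [mul_lt_mul_of_pos_left hle h0, mul_lt_mul_of_pos_left hb (sub_pos.mpr h1)]
end

section
/- Suppose α + g(α) ≥ 1. Then the α-RetroRenting policy never uses partial hosting: the hosting sequence r^{RR} it produces satisfies r^{RR}_t ∈ {0,1} for every t ∈ {1,…,T+1}, for every arrival sequence x and rent-cost sequence c. -/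
open Finset

open scoped Classical

/-- Per-slot cost (rent + latency) at level `lvl` in slot `l`. -/
noncomputable def slotCost (gα : ℝ) (x c : ℕ → ℝ) (lvl : ℝ) (l : ℕ) : ℝ :=
  lvl * c l + gfun gα lvl * x l

/-- Cost, over slots `tr+1,…,t`, of the candidate strategy that stays at the current
level `rcur` on slots `tr+1,…,τ-1` and is at level `i` on slots `τ,…,t`,
including the switch cost `M * |i - rcur|` if `i ≠ rcur`. -/
noncomputable def candCost (gα M : ℝ) (x c : ℕ → ℝ) (rcur i : ℝ) (tr τ t : ℕ) : ℝ :=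
  (∑ l ∈ Finset.Ico (tr + 1) τ, slotCost gα x c rcur l)
    + (∑ l ∈ Finset.Icc τ t, slotCost gα x c i l)
    + (if i = rcur then 0 else M * |i - rcur|)

/-- `minCost(i)`: minimum candidate cost over switch times `τ ∈ (t_recent, t]`. -/
noncomputable def minCostRR (gα M : ℝ) (x c : ℕ → ℝ) (rcur : ℝ) (tr t : ℕ) (i : ℝ) : ℝ :=
  sInf ((fun τ => candCost gα M x c rcur i tr τ t) '' (Set.Icc (tr + 1) t))

/-- The level chosen by α-RetroRenting for the next slot: the level in `{0, α, 1}`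
minimizing `minCost`, ties broken in favor of the current level, then the smaller level. -/
noncomputable def rrNext (α gα M : ℝ) (x c : ℕ → ℝ) (rcur : ℝ) (tr t : ℕ) : ℝ :=
  let mc := minCostRR gα M x c rcur tr t
  if mc rcur ≤ mc 0 ∧ mc rcur ≤ mc α ∧ mc rcur ≤ mc 1 then rcur
  else if mc 0 ≤ mc α ∧ mc 0 ≤ mc 1 then 0
  else if mc α ≤ mc 1 then α
  else 1

/-- State of α-RetroRenting after slot `t`: `(r^{RR}_{t+1}, t_recent)`. -/
noncomputable def rrState (α gα M : ℝ) (x c : ℕ → ℝ) : ℕ → ℝ × ℕ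
  | 0 => (0, 0)
  | t + 1 =>
    let s := rrState α gα M x c t
    let nxt := rrNext α gα M x c s.1 s.2 (t + 1)
    (nxt, if nxt = s.1 then s.2 else t + 1)

/-- The hosting sequence produced by the α-RetroRenting policy. -/
noncomputable def rrSeq (α gα M : ℝ) (x c : ℕ → ℝ) (t : ℕ) : ℝ :=
  (rrState α gα M x c (t - 1)).1

theorem aux_cand (α gα M : ℝ) (x c : ℕ → ℝ) (hα : α ∈ Set.Ioo (0 : ℝ) 1)
    (hsum : 1 ≤ α + gα) (rcur : ℝ) (hr : rcur = 0 ∨ rcur = 1) (tr τ t : ℕ)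
    (hx : ∀ l ∈ Finset.Icc τ t, 0 ≤ x l) :
    α * candCost gα M x c rcur 1 tr τ t + (1 - α) * candCost gα M x c rcur 0 tr τ t
      ≤ candCost gα M x c rcur α tr τ t := by
  obtain ⟨h0, h1⟩ := hα
  have hs : α * (∑ l ∈ Finset.Icc τ t, slotCost gα x c 1 l)
      + (1 - α) * (∑ l ∈ Finset.Icc τ t, slotCost gα x c 0 l)
      ≤ ∑ l ∈ Finset.Icc τ t, slotCost gα x c α l := by
    rw [Finset.mul_sum, Finset.mul_sum, ← Finset.sum_add_distrib]
    apply Finset.sum_le_sum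
    intro l hl
    have := hx l hl
    simp only [slotCost, gfun, h0.ne', h1.ne, if_true, if_false, one_ne_zero]
    nlinarith
  have hw : α * (if (1:ℝ) = rcur then 0 else M * |1 - rcur|)
      + (1 - α) * (if (0:ℝ) = rcur then 0 else M * |0 - rcur|)
      = (if α = rcur then 0 else M * |α - rcur|) := by
    rcases hr with rfl | rfl
    · simp [h0.ne', abs_of_pos h0]; ring
    · have : |α - 1| = 1 - α := by rw [abs_of_neg (by linarith)]; ring
      simp [h1.ne, this]; ring
  unfold candCost
  rw [← hw]
  linarith

theorem aux_mc (α gα M : ℝ) (x c : ℕ → ℝ) (hα : α ∈ Set.Ioo (0 : ℝ) 1)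
    (hsum : 1 ≤ α + gα) (rcur : ℝ) (hr : rcur = 0 ∨ rcur = 1) (tr t : ℕ) (ht : tr + 1 ≤ t)
    (hx : ∀ l ∈ Finset.Icc 1 t, 0 ≤ x l) :
    α * minCostRR gα M x c rcur tr t 1 + (1 - α) * minCostRR gα M x c rcur tr t 0
      ≤ minCostRR gα M x c rcur tr t α := by
  have hle : ∀ i, ∀ τ ∈ Set.Icc (tr + 1) t,
      minCostRR gα M x c rcur tr t i ≤ candCost gα M x c rcur i tr τ t := by
    intro i τ hτ
    exact csInf_le ((Set.finite_Icc _ _).image _).bddBelow (Set.mem_image_of_mem _ hτ)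
  apply le_csInf
  · exact (Set.nonempty_Icc.2 ht).image _
  · rintro _ ⟨τ, hτ, rfl⟩
    have h := aux_cand α gα M x c hα hsum rcur hr tr τ t (fun l hl => hx l (by
      simp only [Finset.mem_Icc, Set.mem_Icc] at *; omega))
    have a := mul_le_mul_of_nonneg_left (hle 1 τ hτ) hα.1.le
    have b := mul_le_mul_of_nonneg_left (hle 0 τ hτ) (sub_nonneg.2 hα.2.le)
    exact (add_le_add a b).trans h

theorem aux_next (α gα M : ℝ) (x c : ℕ → ℝ) (hα : α ∈ Set.Ioo (0 : ℝ) 1)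
    (hsum : 1 ≤ α + gα) (rcur : ℝ) (hr : rcur = 0 ∨ rcur = 1) (tr t : ℕ) (ht : tr + 1 ≤ t)
    (hx : ∀ l ∈ Finset.Icc 1 t, 0 ≤ x l) :
    rrNext α gα M x c rcur tr t = 0 ∨ rrNext α gα M x c rcur tr t = 1 := by
  have h := aux_mc α gα M x c hα hsum rcur hr tr t ht hx
  obtain ⟨h0, h1⟩ := hα
  simp only [rrNext]
  split_ifs with p q r
  · exact hr
  · exact Or.inl rfl
  · exfalso
    have hlt : minCostRR gα M x c rcur tr t α < minCostRR gα M x c rcur tr t 0 := by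
      by_contra hn
      push Not at hn
      exact q ⟨hn, hn.trans r⟩
    nlinarith
  · exact Or.inr rfl

/-- if `α + g(α) ≥ 1`, the α-RetroRenting policy never uses partial
hosting: its hosting sequence takes values in `{0, 1}` only. -/
theorem rr_no_partial_hosting
    (T : ℕ) (α gα M cmin cmax : ℝ) (x c : ℕ → ℝ)
    (hα : α ∈ Set.Ioo (0 : ℝ) 1) (hgα : gα ∈ Set.Ioo (0 : ℝ) 1) (hM : 1 < M)
    (hx : ∀ t ∈ Finset.Icc 1 T, x t = 0 ∨ x t = 1)
    (hcmin : 0 < cmin) (hc : ∀ t ∈ Finset.Icc 1 T, cmin ≤ c t ∧ c t ≤ cmax)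
    (hsum : 1 ≤ α + gα) :
    ∀ t ∈ Finset.Icc 1 (T + 1), rrSeq α gα M x c t = 0 ∨ rrSeq α gα M x c t = 1 := by
  have key : ∀ n, n ≤ T → ((rrState α gα M x c n).1 = 0 ∨ (rrState α gα M x c n).1 = 1)
      ∧ (rrState α gα M x c n).2 ≤ n := by
    intro n
    induction n with
    | zero => intro _; simp [rrState]
    | succ n ih =>
      intro hn
      obtain ⟨h1, h2⟩ := ih (by omega)
      refine ⟨?_, ?_⟩
      · exact aux_next α gα M x c hα hsum _ h1 _ _ (by omega) (fun l hl => by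
          rcases hx l (by simp only [Finset.mem_Icc] at *; omega) with h | h <;> rw [h] <;> norm_num)
      · simp only [rrState]
        split_ifs <;> omega
  intro t ht
  exact (key (t - 1) (by simp only [Finset.mem_Icc] at ht; omega)).1
end

section
/- Suppose c_min ≥ 1 and α·c_min + g(α) ≥ 1. Then the α-RetroRenting policy never fetches any part of the service (r^{RR}_t = 0 for all t ∈ {1,…,T+1}) and its total cost equals the offline optimal cost: C(r^{RR}) = C^{α-OPT}, i.e., α-RetroRenting is 1-competitive. -/
open Finset

open scoped Classical

lemma slot_le_aux
    (T : ℕ) (α gα cmin cmax : ℝ) (x c : ℕ → ℝ)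
    (hα : α ∈ Set.Ioo (0 : ℝ) 1) (hgα : gα ∈ Set.Ioo (0 : ℝ) 1)
    (hx : ∀ t ∈ Finset.Icc 1 T, x t = 0 ∨ x t = 1)
    (hc : ∀ t ∈ Finset.Icc 1 T, cmin ≤ c t ∧ c t ≤ cmax)
    (hc1 : 1 ≤ cmin) (hcond : 1 ≤ α * cmin + gα)
    (l : ℕ) (hl : l ∈ Finset.Icc 1 T) (i : ℝ) (hi : i ∈ ({0, α, 1} : Set ℝ)) :
    slotCost gα x c 0 l ≤ slotCost gα x c i l := by
  obtain ⟨h1, h2⟩ := hα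
  obtain ⟨h3, h4⟩ := hgα
  have hcl := (hc l hl).1
  have hm : α * cmin ≤ α * c l := mul_le_mul_of_nonneg_left hcl h1.le
  have hp : 0 < α * c l := mul_pos h1 (by linarith)
  simp only [Set.mem_insert_iff, Set.mem_singleton_iff] at hi
  rcases hi with rfl | rfl | rfl
  · exact le_rfl
  · have e0 : i ≠ 0 := h1.ne'
    have e1 : i ≠ 1 := h2.ne
    rcases hx l hl with h | h <;> simp [slotCost, gfun, h, e0, e1] <;> linarith
  · rcases hx l hl with h | h <;> simp [slotCost, gfun, h] <;> linarith

lemma minCost_le_aux (gα M : ℝ) (x c : ℕ → ℝ) (hM : 1 < M) (i : ℝ) (t : ℕ)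
    (h : ∀ l ∈ Finset.Icc 1 (t + 1), slotCost gα x c 0 l ≤ slotCost gα x c i l) :
    minCostRR gα M x c 0 0 (t + 1) 0 ≤ minCostRR gα M x c 0 0 (t + 1) i := by
  unfold minCostRR
  apply le_csInf
  · exact (Set.nonempty_Icc.2 (by omega)).image _
  · rintro _ ⟨τ, hτ, rfl⟩
    refine le_trans (csInf_le ((Set.finite_Icc _ _).image _).bddBelow ⟨τ, hτ, rfl⟩) ?_
    simp only [candCost, if_true]
    have hs : ∑ l ∈ Finset.Icc τ (t + 1), slotCost gα x c 0 l
        ≤ ∑ l ∈ Finset.Icc τ (t + 1), slotCost gα x c i l := by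
      apply Finset.sum_le_sum
      intro l hl
      apply h
      rw [Finset.mem_Icc] at hl ⊢
      have := hτ.1
      omega
    have hn : 0 ≤ (if i = 0 then 0 else M * |i - 0|) := by
      split_ifs
      · exact le_rfl
      · positivity
    linarith

/-- if `c_min ≥ 1` and `α·c_min + g(α) ≥ 1`, the α-RetroRenting policy
never fetches any part of the service and its total cost equals the offline optimal
cost, i.e., it is 1-competitive. -/
theorem rr_never_fetches_and_is_optimal
    (T : ℕ) (α gα M cmin cmax : ℝ) (x c : ℕ → ℝ)
    (hα : α ∈ Set.Ioo (0 : ℝ) 1) (hgα : gα ∈ Set.Ioo (0 : ℝ) 1) (hM : 1 < M)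
    (hx : ∀ t ∈ Finset.Icc 1 T, x t = 0 ∨ x t = 1)
    (hcmin : 0 < cmin) (hc : ∀ t ∈ Finset.Icc 1 T, cmin ≤ c t ∧ c t ≤ cmax)
    (hc1 : 1 ≤ cmin) (hcond : 1 ≤ α * cmin + gα) :
    (∀ t ∈ Finset.Icc 1 (T + 1), rrSeq α gα M x c t = 0) ∧
      (∀ r : ℕ → ℝ, IsHosting α T r →
        hostCost gα M x c T (rrSeq α gα M x c) ≤ hostCost gα M x c T r) := by
  have slot := slot_le_aux T α gα cmin cmax x c hα hgα hx hc hc1 hcond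
  have st : ∀ t, t ≤ T → rrState α gα M x c t = (0, 0) := by
    intro t
    induction t with
    | zero => intro _; rfl
    | succ t ih =>
      intro ht
      have hi : ∀ i ∈ ({0, α, 1} : Set ℝ),
          minCostRR gα M x c 0 0 (t + 1) 0 ≤ minCostRR gα M x c 0 0 (t + 1) i := by
        intro i hi
        apply minCost_le_aux gα M x c hM
        intro l hl
        refine slot l ?_ i hi
        rw [Finset.mem_Icc] at hl ⊢
        omega
      have hn : rrNext α gα M x c 0 0 (t + 1) = 0 := by
        unfold rrNext
        exact if_pos ⟨hi 0 (by simp), hi α (by simp), hi 1 (by simp)⟩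
      simp [rrState, ih (by omega), hn]
  have hz : ∀ t ∈ Finset.Icc 1 (T + 1), rrSeq α gα M x c t = 0 := by
    intro t ht
    rw [Finset.mem_Icc] at ht
    simp [rrSeq, st (t - 1) (by omega)]
  refine ⟨hz, fun r hr => ?_⟩
  apply Finset.sum_le_sum
  intro t ht
  have ht' := Finset.mem_Icc.1 ht
  have hs := slot t ht (r t) (hr.2 t (Finset.mem_Icc.2 (by omega)))
  rw [hz t (Finset.mem_Icc.2 (by omega)), hz (t + 1) (Finset.mem_Icc.2 (by omega))]
  have hmx : 0 ≤ M * max (r (t + 1) - r t) 0 :=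
    mul_nonneg (by linarith) (le_max_right _ _)
  simp only [slotCost] at hs
  simp only [sub_self, max_self, mul_zero]
  linarith
end

section
/- Let (a,b) ∈ {(0,α), (0,1), (α,1−α)} and let r* be an α-OPT sequence. If 1 < n ≤ m ≤ T, r*_{n−1} = a, r*_t = a+b for all n ≤ t ≤ m, and r*_{m+1} = a, then (g(a) − g(a+b)) · Σ_{l=n}^{m} x_l ≥ b·M + b · Σ_{l=n}^{m} c_l. -/
open Finset

/-- Lemma 1: if the optimal sequence goes from level `a` up to `a+b`
on slots `n,…,m` and back to `a`, then the accumulated latency savings justify the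
fetch and rent costs. -/
theorem opt_hosting_interval_bound
    (T : ℕ) (α gα M cmin cmax : ℝ) (x c : ℕ → ℝ)
    (hα : α ∈ Set.Ioo (0 : ℝ) 1) (hgα : gα ∈ Set.Ioo (0 : ℝ) 1) (hM : 1 < M)
    (hx : ∀ t ∈ Finset.Icc 1 T, x t = 0 ∨ x t = 1)
    (hcmin : 0 < cmin) (hc : ∀ t ∈ Finset.Icc 1 T, cmin ≤ c t ∧ c t ≤ cmax)
    (a b : ℝ)
    (hab : (a, b) = ((0 : ℝ), α) ∨ (a, b) = ((0 : ℝ), (1 : ℝ)) ∨ (a, b) = (α, 1 - α))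
    (rstar : ℕ → ℝ) (hopt : IsOptSeq α gα M x c T rstar)
    (n m : ℕ) (hn : 1 < n) (hnm : n ≤ m) (hm : m ≤ T)
    (h1 : rstar (n - 1) = a)
    (h2 : ∀ t ∈ Finset.Icc n m, rstar t = a + b)
    (h3 : rstar (m + 1) = a) :
    b * M + b * ∑ l ∈ Finset.Icc n m, c l ≤
      (gfun gα a - gfun gα (a + b)) * ∑ l ∈ Finset.Icc n m, x l := by
  obtain ⟨hα0, hα1⟩ := hα
  have hb : 0 < b := by
    rcases hab with h | h | h <;> simp only [Prod.mk.injEq] at h <;> linarith [h.2]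
  have ha : a ∈ ({0, α, 1} : Set ℝ) := by
    rcases hab with h | h | h <;> simp only [Prod.mk.injEq] at h <;> simp [h.1]
  obtain ⟨⟨hr1, hr⟩, hmin⟩ := hopt
  set r' : ℕ → ℝ := fun t => if n ≤ t ∧ t ≤ m then a else rstar t with hr'
  have hin : ∀ t, n ≤ t → t ≤ m → r' t = a := fun t p q => by simp [hr', p, q]
  have hout : ∀ t, ¬ (n ≤ t ∧ t ≤ m) → r' t = rstar t := fun t p => by simp only [hr', if_neg p]
  have hhost : IsHosting α T r' := by
    refine ⟨by rw [hout 1 (by omega), hr1], fun t ht => ?_⟩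
    by_cases h : n ≤ t ∧ t ≤ m
    · rw [hin t h.1 h.2]; exact ha
    · rw [hout t h]; exact hr t ht
  have hle := hmin r' hhost
  have key : hostCost gα M x c T rstar = hostCost gα M x c T r' +
      (∑ t ∈ Finset.Icc 1 T, (if t ∈ Finset.Icc n m then
        (b * c t + (gfun gα (a + b) - gfun gα a) * x t) else 0)
       + ∑ t ∈ Finset.Icc 1 T, (if t = n - 1 then b * M else 0)) := by
    unfold hostCost
    rw [← Finset.sum_add_distrib, ← Finset.sum_add_distrib]
    refine Finset.sum_congr rfl fun t ht => ?_
    by_cases h : n ≤ t ∧ t ≤ m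
    · have e1 : rstar t = a + b := h2 t (Finset.mem_Icc.2 h)
      have e2 : r' t = a := hin t h.1 h.2
      have e3 : max (rstar (t + 1) - rstar t) 0 = 0 := by
        apply max_eq_right
        by_cases hh : t = m
        · subst hh; rw [h3, e1]; linarith
        · rw [e1, h2 (t + 1) (Finset.mem_Icc.2 ⟨by omega, by omega⟩)]; linarith
      have e4 : max (r' (t + 1) - r' t) 0 = 0 := by
        apply max_eq_right
        by_cases hh : t = m
        · subst hh; rw [hout _ (by omega), h3, e2]; linarith
        · rw [e2, hin (t + 1) (by omega) (by omega)]; linarith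
      rw [e3, e4, e1, e2, if_pos (Finset.mem_Icc.2 h), if_neg (by omega)]
      ring
    · rw [hout t h, if_neg (by rw [Finset.mem_Icc]; exact h)]
      by_cases hh : t = n - 1
      · have e5 : t + 1 = n := by omega
        rw [if_pos hh, e5, hin n le_rfl hnm, h2 n (Finset.mem_Icc.2 ⟨le_rfl, hnm⟩), hh, h1,
          max_eq_left (by linarith), max_eq_left (by linarith)]
        ring
      · rw [if_neg hh, hout (t + 1) (by omega)]
        ring
  have s1 : ∑ t ∈ Finset.Icc 1 T, (if t = n - 1 then b * M else 0) = b * M := by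
    rw [Finset.sum_ite_eq', if_pos (Finset.mem_Icc.2 ⟨by omega, by omega⟩)]
  have s2 : (Finset.Icc 1 T) ∩ Finset.Icc n m = Finset.Icc n m :=
    Finset.inter_eq_right.2 (Finset.Icc_subset_Icc (by omega) hm)
  rw [s1, Finset.sum_ite_mem, s2, Finset.sum_add_distrib, ← Finset.mul_sum,
    ← Finset.mul_sum] at key
  linarith
end

section
/- Let (a,b) ∈ {(0,α), (0,1), (α,1−α)} and let r* be an α-OPT sequence. If 1 < n ≤ m ≤ T, r*_{n−1} = a, and (g(a) − g(a+b)) · Σ_{l=n}^{m} x_l > b·M + b · Σ_{l=n}^{m} c_l, then there exists at least one τ with n ≤ τ ≤ m such that r*_τ ≠ a. -/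
open Finset

/-- Lemma 2: if the latency savings over `n,…,m` strictly exceed the
fetch and rent costs of moving from level `a` to `a+b`, then the optimal sequence
cannot stay at level `a` throughout `n,…,m`. -/
theorem opt_must_move
    (T : ℕ) (α gα M cmin cmax : ℝ) (x c : ℕ → ℝ)
    (hα : α ∈ Set.Ioo (0 : ℝ) 1) (hgα : gα ∈ Set.Ioo (0 : ℝ) 1) (hM : 1 < M)
    (hx : ∀ t ∈ Finset.Icc 1 T, x t = 0 ∨ x t = 1)
    (hcmin : 0 < cmin) (hc : ∀ t ∈ Finset.Icc 1 T, cmin ≤ c t ∧ c t ≤ cmax)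
    (a b : ℝ)
    (hab : (a, b) = ((0 : ℝ), α) ∨ (a, b) = ((0 : ℝ), (1 : ℝ)) ∨ (a, b) = (α, 1 - α))
    (rstar : ℕ → ℝ) (hopt : IsOptSeq α gα M x c T rstar)
    (n m : ℕ) (hn : 1 < n) (hnm : n ≤ m) (hm : m ≤ T)
    (h1 : rstar (n - 1) = a)
    (h2 : b * M + b * ∑ l ∈ Finset.Icc n m, c l <
      (gfun gα a - gfun gα (a + b)) * ∑ l ∈ Finset.Icc n m, x l) :
    ∃ τ ∈ Finset.Icc n m, rstar τ ≠ a := by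
  by_contra hcon
  push Not at hcon
  obtain ⟨⟨hr1, hrm⟩, hmin⟩ := hopt
  have hb : 0 < b := by
    rcases hab with h | h | h <;> simp only [Prod.mk.injEq] at h <;> linarith [hα.1, hα.2]
  have hmem : a + b ∈ ({0, α, 1} : Set ℝ) := by
    rcases hab with h | h | h <;> simp only [Prod.mk.injEq] at h <;> rw [h.1, h.2] <;> simp
  set r' : ℕ → ℝ := fun t => if t ∈ Finset.Icc n m then a + b else rstar t with hr'
  have hin : ∀ t, t ∈ Finset.Icc n m → r' t = a + b := fun t ht => by
    simp only [hr']; rw [if_pos ht]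
  have hout : ∀ t, t ∉ Finset.Icc n m → r' t = rstar t := fun t ht => by
    simp only [hr']; rw [if_neg ht]
  have hH : IsHosting α T r' := by
    constructor
    · rw [hout 1 (by simp; omega)]; exact hr1
    · intro t ht
      by_cases h : t ∈ Finset.Icc n m
      · rw [hin t h]; exact hmem
      · rw [hout t h]; exact hrm t ht
  have hle := hmin r' hH
  have hpt : hostCost gα M x c T r' ≤ ∑ t ∈ Finset.Icc 1 T,
      ((rstar t * c t + gfun gα (rstar t) * x t + M * max (rstar (t + 1) - rstar t) 0)
        + (if t ∈ Finset.Icc n m then b * c t - (gfun gα a - gfun gα (a + b)) * x t else 0)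
        + (if t = n - 1 then b * M else 0)) := by
    unfold hostCost
    apply Finset.sum_le_sum
    intro t ht
    by_cases h : t ∈ Finset.Icc n m
    · have hne : t ≠ n - 1 := by
        rw [Finset.mem_Icc] at h; omega
      rw [if_pos h, if_neg hne, hin t h, hcon t h]
      have : max (r' (t + 1) - (a + b)) 0 ≤ max (rstar (t + 1) - a) 0 := by
        by_cases h' : t + 1 ∈ Finset.Icc n m
        · rw [hin _ h', hcon _ h']; simp
        · rw [hout _ h']; exact max_le_max (by linarith) le_rfl
      have := mul_le_mul_of_nonneg_left this (by linarith : 0 ≤ M)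
      linarith
    · rw [if_neg h, hout t h]
      by_cases hne : t = n - 1
      · have h' : t + 1 ∈ Finset.Icc n m := by rw [Finset.mem_Icc]; omega
        rw [if_pos hne, hin _ h', hcon _ h', hne, h1]
        have e : a + b - a = b := by ring
        rw [e, sub_self, max_eq_left hb.le, max_self]
        linarith
      · have h' : t + 1 ∉ Finset.Icc n m := by
          rw [Finset.mem_Icc] at h ⊢; omega
        rw [if_neg hne, hout _ h']; linarith
  rw [Finset.sum_add_distrib, Finset.sum_add_distrib, Finset.sum_ite_mem,
    Finset.sum_ite_eq', if_pos (by rw [Finset.mem_Icc]; omega),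
    Finset.inter_eq_right.2 (Finset.Icc_subset_Icc (by omega) hm),
    Finset.sum_sub_distrib, ← Finset.mul_sum, ← Finset.mul_sum] at hpt
  unfold hostCost at hpt hle
  linarith
end

section
/- Let b ∈ {α, 1} and suppose b·c_min + g(b) ≥ 1. Let 1 ≤ n < m ≤ T and let r be a hosting sequence with r_n = 0, r_t = b for all n < t ≤ m, and r_{m+1} = 0. Let η be the hosting sequence that agrees with r everywhere except η_t = 0 for n < t ≤ m. Then C(η) < C(r). Consequently, no α-OPT sequence fetches the level-b fraction of the service in this way. -/
open Finset

/-- Lemma 3, first part: if `b·c_min + g(b) ≥ 1` for `b ∈ {α, 1}`,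
then replacing a hosted excursion `0 → b → 0` by not hosting strictly lowers the
cost; consequently no α-OPT sequence fetches the level-`b` fraction in this way. -/
theorem no_fetch_when_rent_high
    (T : ℕ) (α gα M cmin cmax : ℝ) (x c : ℕ → ℝ)
    (hα : α ∈ Set.Ioo (0 : ℝ) 1) (hgα : gα ∈ Set.Ioo (0 : ℝ) 1) (hM : 1 < M)
    (hx : ∀ t ∈ Finset.Icc 1 T, x t = 0 ∨ x t = 1)
    (hcmin : 0 < cmin) (hc : ∀ t ∈ Finset.Icc 1 T, cmin ≤ c t ∧ c t ≤ cmax)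
    (b : ℝ) (hb : b = α ∨ b = 1)
    (hcond : 1 ≤ b * cmin + gfun gα b)
    (n m : ℕ) (hn : 1 ≤ n) (hnm : n < m) (hm : m ≤ T)
    (r : ℕ → ℝ) (hr : IsHosting α T r)
    (h1 : r n = 0)
    (h2 : ∀ t : ℕ, n < t → t ≤ m → r t = b)
    (h3 : r (m + 1) = 0) :
    hostCost gα M x c T (fun t => if n < t ∧ t ≤ m then 0 else r t) <
        hostCost gα M x c T r ∧
      ¬ IsOptSeq α gα M x c T r := by
  have hb0 : 0 < b := by
    rcases hb with h | h
    · rw [h]; exact hα.1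
    · rw [h]; exact one_pos
  have hM0 : 0 < M := by linarith
  have hlt : hostCost gα M x c T (fun t => if n < t ∧ t ≤ m then 0 else r t) <
      hostCost gα M x c T r := by
    unfold hostCost
    apply Finset.sum_lt_sum
    · intro t ht
      have hc1 := (hc t ht).1
      have hx1 := hx t ht
      by_cases hin : n < t ∧ t ≤ m
      · have e1 : (if n < t + 1 ∧ t + 1 ≤ m then (0 : ℝ) else r (t + 1)) = 0 := by
          split_ifs with h
          · rfl
          · have : t = m := by omega
            rw [this, h3]
        simp only [e1, if_pos hin, h2 t hin.1 hin.2]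
        have hg0 : gfun gα 0 = 1 := by simp [gfun]
        have hmx : 0 ≤ M * max (r (t + 1) - b) 0 :=
          mul_nonneg hM0.le (le_max_right _ _)
        have hbc : b * cmin ≤ b * c t := mul_le_mul_of_nonneg_left hc1 hb0.le
        have hbp : 0 < b * cmin := mul_pos hb0 hcmin
        rw [hg0, sub_self, max_self]
        rcases hx1 with h | h <;> rw [h] <;> linarith
      · simp only [if_neg hin]
        by_cases hin2 : n < t + 1 ∧ t + 1 ≤ m
        · have e : r (t + 1) = b := h2 _ hin2.1 hin2.2
          simp only [if_pos hin2, e]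
          gcongr
        · simp only [if_neg hin2]; exact le_rfl
    · refine ⟨n, Finset.mem_Icc.2 ⟨hn, by omega⟩, ?_⟩
      have a1 : ¬ (n < n ∧ n ≤ m) := by omega
      have a2 : n < n + 1 ∧ n + 1 ≤ m := by omega
      simp only [if_neg a1, if_pos a2, h1, h2 (n + 1) a2.1 a2.2]
      rw [sub_self, max_self, sub_zero, max_eq_left hb0.le]
      have := mul_pos hM0 hb0
      linarith
  refine ⟨hlt, fun hopt => ?_⟩
  refine absurd (hopt.2 _ ⟨?_, ?_⟩) (not_le.2 hlt)
  · skip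
    split_ifs
    · rfl
    · exact hr.1
  · intro t ht
    skip
    split_ifs
    · simp
    · exact hr.2 t ht
end

section
/- Suppose α·c_min + g(α) ≤ c_min. Let 1 ≤ n < m ≤ T and let r be a hosting sequence with r_n = α, r_t = 1 for all n < t ≤ m, and r_{m+1} ∈ {0, α}. Let η be the hosting sequence that agrees with r everywhere except η_t = α for n < t ≤ m. Then C(η) < C(r). Consequently, no α-OPT sequence fetches the remaining (1−α) fraction of the service in this way. -/
open Finset

/-- Lemma 3, second part: if `α·c_min + g(α) ≤ c_min`, then replacing a
full-hosting excursion `α → 1 → {0, α}` by staying at level `α` strictly lowers the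
cost; consequently no α-OPT sequence fetches the remaining `1 - α` fraction this way. -/
theorem no_fetch_remaining_fraction
    (T : ℕ) (α gα M cmin cmax : ℝ) (x c : ℕ → ℝ)
    (hα : α ∈ Set.Ioo (0 : ℝ) 1) (hgα : gα ∈ Set.Ioo (0 : ℝ) 1) (hM : 1 < M)
    (hx : ∀ t ∈ Finset.Icc 1 T, x t = 0 ∨ x t = 1)
    (hcmin : 0 < cmin) (hc : ∀ t ∈ Finset.Icc 1 T, cmin ≤ c t ∧ c t ≤ cmax)
    (hcond : α * cmin + gα ≤ cmin)
    (n m : ℕ) (hn : 1 ≤ n) (hnm : n < m) (hm : m ≤ T)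
    (r : ℕ → ℝ) (hr : IsHosting α T r)
    (h1 : r n = α)
    (h2 : ∀ t : ℕ, n < t → t ≤ m → r t = 1)
    (h3 : r (m + 1) = 0 ∨ r (m + 1) = α) :
    hostCost gα M x c T (fun t => if n < t ∧ t ≤ m then α else r t) <
        hostCost gα M x c T r ∧
      ¬ IsOptSeq α gα M x c T r := by
  obtain ⟨ha0, ha1⟩ := hα
  obtain ⟨hg0, hg1⟩ := hgα
  have key : hostCost gα M x c T (fun t => if n < t ∧ t ≤ m then α else r t) <
      hostCost gα M x c T r := by
    unfold hostCost
    have hn' : (if n < n ∧ n ≤ m then α else r n) = α := by simp [h1]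
    have hn1 : (if n < n + 1 ∧ n + 1 ≤ m then α else r (n + 1)) = α := by
      rw [if_pos ⟨by omega, by omega⟩]
    apply Finset.sum_lt_sum
    · intro t ht
      have hct := hc t ht
      have hxt := hx t ht
      by_cases hin : n < t ∧ t ≤ m
      · have e1 : (if n < t ∧ t ≤ m then α else r t) = α := if_pos hin
        have e2 : (if n < t + 1 ∧ t + 1 ≤ m then α else r (t + 1)) ≤ α := by
          by_cases h : t + 1 ≤ m
          · rw [if_pos ⟨by omega, h⟩]
          · rw [if_neg (by omega)]
            have : t = m := by omega
            subst this
            rcases h3 with h3 | h3 <;> rw [h3]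
            exact ha0.le
        have e3 : r t = 1 := h2 t hin.1 hin.2
        have ga : gfun gα α = gα := by
          unfold gfun; rw [if_neg ha0.ne', if_neg ha1.ne]
        have g1 : gfun gα 1 = 0 := by simp [gfun]
        have mx := mul_nonneg (by linarith : (0:ℝ) ≤ M) (le_max_right (r (t + 1) - 1) 0)
        simp only [e1]
        rw [max_eq_right (sub_nonpos.mpr e2), e3, ga, g1]
        have hp := mul_le_mul_of_nonneg_left hct.1 (by linarith : (0:ℝ) ≤ 1 - α)
        rcases hxt with h | h <;> rw [h] <;> nlinarith
      · have e1 : (if n < t ∧ t ≤ m then α else r t) = r t := if_neg hin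
        by_cases htn : t = n
        · subst htn
          simp only [hn1, h1, ite_self, sub_self, max_self]
          have mx := mul_nonneg (by linarith : (0:ℝ) ≤ M) (le_max_right (r (t + 1) - α) 0)
          linarith
        · have e2 : (if n < t + 1 ∧ t + 1 ≤ m then α else r (t + 1)) = r (t + 1) :=
            if_neg (by omega)
          simp only [e1, e2]
          exact le_refl _
    · refine ⟨n, Finset.mem_Icc.mpr ⟨hn, by omega⟩, ?_⟩
      simp only [hn1, h1, ite_self, sub_self, max_self]
      rw [h2 (n + 1) (by omega) (by omega), max_eq_left (by linarith)]
      nlinarith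
  refine ⟨key, fun hopt => absurd (hopt.2 _ ⟨?_, ?_⟩) (not_le.mpr key)⟩
  · show (if n < 1 ∧ 1 ≤ m then α else r 1) = 0
    rw [if_neg (by omega)]
    exact hr.1
  · intro t ht
    show (if n < t ∧ t ≤ m then α else r t) ∈ _
    split_ifs
    · simp
    · exact hr.2 t ht
end

section
/- Let (a,b) ∈ {(0,α), (0,1), (α,1−α)}. Suppose an α-OPT sequence r* satisfies r*_{n−1} = a+b and r*_n = a, and the α-RetroRenting hosting sequence satisfies r^{RR}_t = a+b for all n ≤ t ≤ m and r^{RR}_{m+1} = a (with 1 < n ≤ m ≤ T). Then (g(a) − g(a+b)) · Σ_{l=n}^{m} x_l ≥ b · Σ_{l=n}^{m−1} c_l − M·b. -/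
open Finset

open scoped Classical

theorem aux_tr_le (α gα M : ℝ) (x c : ℕ → ℝ) (t : ℕ) : (rrState α gα M x c t).2 ≤ t := by
  induction t with
  | zero => simp [rrState]
  | succ t ih =>
    simp only [rrState]
    split_ifs <;> omega

theorem aux_next_s11 (α gα M : ℝ) (x c : ℕ → ℝ) (h : ℝ) (tr t : ℕ)
    (hn : rrNext α gα M x c h tr t = h) (i : ℝ) (hi : i = 0 ∨ i = α ∨ i = 1) :
    minCostRR gα M x c h tr t h ≤ minCostRR gα M x c h tr t i := by
  unfold rrNext at hn
  simp only at hn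
  generalize hmc : minCostRR gα M x c h tr t = mc at *
  split_ifs at hn with h1 h2 h3
  · rcases hi with rfl | rfl | rfl
    exacts [h1.1, h1.2.1, h1.2.2]
  · subst hn
    exact absurd ⟨le_refl _, h2.1, h2.2⟩ h1
  · subst hn
    have : mc α ≤ mc 0 := by
      by_contra hh
      push Not at hh
      exact h2 ⟨hh.le, hh.le.trans h3⟩
    exact absurd ⟨this, le_refl _, h3⟩ h1
  · subst hn
    push Not at h3
    have : mc 1 ≤ mc 0 := by
      by_contra hh
      push Not at hh
      exact h2 ⟨(hh.trans h3).le, hh.le⟩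
    exact absurd ⟨this, h3.le, le_refl _⟩ h1

theorem aux_cost (gα M : ℝ) (x c : ℕ → ℝ) (h a : ℝ) (tr t n : ℕ) (hn : tr + 1 ≤ n) (hnt : n ≤ t)
    (hah : a ≠ h)
    (hm : minCostRR gα M x c h tr t h ≤ minCostRR gα M x c h tr t a) :
    ∑ l ∈ Finset.Icc n t, slotCost gα x c h l ≤
      ∑ l ∈ Finset.Icc n t, slotCost gα x c a l + M * |a - h| := by
  have e : ∀ τ ∈ Set.Icc (tr + 1) t, candCost gα M x c h h tr τ t
      = candCost gα M x c h h tr n t := by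
    have key : ∀ τ ∈ Set.Icc (tr + 1) t, candCost gα M x c h h tr τ t
        = ∑ l ∈ Finset.Ico (tr + 1) (t + 1), slotCost gα x c h l := by
      intro τ hτ
      have := hτ.1
      have := hτ.2
      unfold candCost
      rw [← Finset.Ico_add_one_right_eq_Icc τ t]
      rw [Finset.sum_Ico_consecutive _ (by omega) (by omega)]
      simp
    intro τ hτ
    rw [key τ hτ, key n ⟨hn, hnt⟩]
  have l1 : candCost gα M x c h h tr n t ≤ minCostRR gα M x c h tr t h := by
    unfold minCostRR
    apply le_csInf
    · exact ⟨_, n, ⟨hn, hnt⟩, rfl⟩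
    · rintro _ ⟨τ, hτ, rfl⟩
      exact (e τ hτ).ge
  have l2 : minCostRR gα M x c h tr t a ≤ candCost gα M x c h a tr n t := by
    unfold minCostRR
    apply csInf_le
    · exact ((Set.finite_Icc _ _).image _).bddBelow
    · exact ⟨n, ⟨hn, hnt⟩, rfl⟩
  have := (l1.trans hm).trans l2
  simp only [candCost, if_true, if_neg hah] at this
  linarith

/-- Lemma 6: if α-OPT drops from level `a+b` to `a` at slot `n` while
α-RetroRenting stays at `a+b` on slots `n,…,m` and drops to `a` only after slot `m`,
then the latency savings over `n,…,m` are bounded below. -/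
theorem rr_min_requests
    (T : ℕ) (α gα M cmin cmax : ℝ) (x c : ℕ → ℝ)
    (hα : α ∈ Set.Ioo (0 : ℝ) 1) (hgα : gα ∈ Set.Ioo (0 : ℝ) 1) (hM : 1 < M)
    (hx : ∀ t ∈ Finset.Icc 1 T, x t = 0 ∨ x t = 1)
    (hcmin : 0 < cmin) (hc : ∀ t ∈ Finset.Icc 1 T, cmin ≤ c t ∧ c t ≤ cmax)
    (a b : ℝ)
    (hab : (a, b) = ((0 : ℝ), α) ∨ (a, b) = ((0 : ℝ), (1 : ℝ)) ∨ (a, b) = (α, 1 - α))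
    (rstar : ℕ → ℝ) (hopt : IsOptSeq α gα M x c T rstar)
    (n m : ℕ) (hn : 1 < n) (hnm : n ≤ m) (hm : m ≤ T)
    (h1 : rstar (n - 1) = a + b) (h2 : rstar n = a)
    (h3 : ∀ t ∈ Finset.Icc n m, rrSeq α gα M x c t = a + b)
    (h4 : rrSeq α gα M x c (m + 1) = a) :
    b * (∑ l ∈ Finset.Icc n (m - 1), c l) - M * b ≤
      (gfun gα a - gfun gα (a + b)) * ∑ l ∈ Finset.Icc n m, x l := by
  obtain ⟨hα0, hα1⟩ := hα
  obtain ⟨hg0, hg1⟩ := hgα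
  have hb : 0 < b ∧ (a = 0 ∨ a = α ∨ a = 1) ∧ gfun gα (a + b) ≤ gfun gα a := by
    rcases hab with h | h | h <;> obtain ⟨rfl, rfl⟩ := Prod.mk.inj h
    · refine ⟨hα0, Or.inl rfl, ?_⟩
      simp [gfun, hα0.ne', hα1.ne, hg1.le]
    · refine ⟨one_pos, Or.inl rfl, ?_⟩
      simp [gfun]
    · refine ⟨by linarith, Or.inr (Or.inl rfl), ?_⟩
      simp [gfun, hα0.ne', hα1.ne, hg0.le]
  obtain ⟨hb, ha, hg⟩ := hb
  have hx0 : ∀ l ∈ Finset.Icc n m, 0 ≤ x l := by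
    intro l hl
    rw [Finset.mem_Icc] at hl
    rcases hx l (Finset.mem_Icc.2 ⟨by omega, by omega⟩) with h | h <;> rw [h] <;> norm_num
  obtain rfl | hlt := hnm.eq_or_lt
  · have : Finset.Icc n (n - 1) = ∅ := Finset.Icc_eq_empty (by omega)
    rw [this, Finset.sum_empty]
    have h5 := mul_nonneg (sub_nonneg.2 hg) (Finset.sum_nonneg hx0)
    nlinarith
  have hst : ∀ t, n ≤ t + 1 → t + 1 ≤ m → (rrState α gα M x c t).1 = a + b := by
    intro t h5 h6
    have := h3 (t + 1) (Finset.mem_Icc.2 ⟨h5, h6⟩)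
    simpa [rrSeq] using this
  have htr : ∀ k, n + k ≤ m → (rrState α gα M x c (n - 1 + k)).2 + 1 ≤ n := by
    intro k
    induction k with
    | zero =>
      intro _
      have := aux_tr_le α gα M x c (n - 1)
      simp only [add_zero]
      omega
    | succ k ih =>
      intro hk
      have i1 := ih (by omega)
      have i2 := hst (n - 1 + k) (by omega) (by omega)
      have i3 := hst (n - 1 + k + 1) (by omega) (by omega)
      rw [← add_assoc]
      simp only [rrState] at i3 ⊢
      rw [if_pos (i3.trans i2.symm)]
      exact i1
  obtain ⟨k, rfl⟩ : ∃ k, m = k + 2 := ⟨m - 2, by omega⟩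
  have t1 := htr (k + 1 - n) (by omega)
  rw [show n - 1 + (k + 1 - n) = k by omega] at t1
  have s1 := hst k (by omega) (by omega)
  have s2 := hst (k + 1) (by omega) (by omega)
  simp only [rrState] at s2
  rw [s1] at s2
  have h6 := aux_cost gα M x c (a + b) a _ (k + 1) n t1 (by omega) (by linarith)
    (aux_next_s11 α gα M x c (a + b) _ (k + 1) s2 a ha)
  rw [show a - (a + b) = -b by ring, abs_neg, abs_of_pos hb] at h6
  simp only [slotCost, Finset.sum_add_distrib, ← Finset.mul_sum] at h6
  have h7 : ∑ l ∈ Finset.Icc n (k + 1), x l ≤ ∑ l ∈ Finset.Icc n (k + 2), x l := by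
    apply Finset.sum_le_sum_of_subset_of_nonneg
    · exact Finset.Icc_subset_Icc_right (by omega)
    · intro l hl _
      exact hx0 l hl
  have h8 := mul_le_mul_of_nonneg_left h7 (sub_nonneg.2 hg)
  rw [show k + 2 - 1 = k + 1 by omega]
  linarith
end
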